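/- Let A = kQ/I be a (locally) gentle algebra. The prime radical of A (the intersection of all prime two-sided ideals) equals the two-sided ideal generated by the arrows α ∈ Q1 whose maximal path γ_α is finite. In particular, A is semiprime if and only if A has no finite maximal paths. -/

import Mathlib

/- Common framework for (locally) gentle algebras -/

noncomputable section
open scoped BigOperators
open CategoryTheory

namespace LocGentle

/-- A finite connected quiver with at least one vertex and one arrow. -/
structure Quiv where
  V : Type
  Arr : Type
  [fintypeV : Fintype V]
  [fintypeA : Fintype Arr]
  [decEqV : DecidableEq V]
  [decEqA : DecidableEq Arr]
  src : Arr → V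
  tgt : Arr → V
  [nonemptyV : Nonempty V]
  [nonemptyA : Nonempty Arr]
  connected : (SimpleGraph.fromRel (fun v w => ∃ a, src a = v ∧ tgt a = w)).Connected

attribute [instance] Quiv.fintypeV Quiv.fintypeA Quiv.decEqV Quiv.decEqA
  Quiv.nonemptyV Quiv.nonemptyA

variable (Q : Quiv)

/-- in-degree of a vertex -/
def indeg (v : Q.V) : ℕ := (Finset.univ.filter (fun a => Q.tgt a = v)).card

/-- out-degree of a vertex -/
def outdeg (v : Q.V) : ℕ := (Finset.univ.filter (fun a => Q.src a = v)).card

/-- a list of arrows is composable (forms a path) -/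
def Composable (l : List Q.Arr) : Prop := l.Chain' (fun a b => Q.tgt a = Q.src b)

variable {Q}

/-- source vertex of a nonempty word -/
def wSrc? (l : List Q.Arr) : Option Q.V := l.head?.map Q.src

/-- target vertex of a nonempty word -/
def wTgt? (l : List Q.Arr) : Option Q.V := l.getLast?.map Q.tgt

/-- target of a word, with a default value (used for stationary paths) -/
def wTgtD (l : List Q.Arr) (v : Q.V) : Q.V := (l.getLast?.map Q.tgt).getD v

/-- last arrow of a word, with a (junk) default -/
def wLast (l : List Q.Arr) : Q.Arr := l.getLast?.getD (Classical.arbitrary _)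

variable (rel : Q.Arr → Q.Arr → Prop)

/-- A word is allowed (is a basis path of `A = kQ/I`) if consecutive arrows are
composable and no consecutive pair lies in the relation set generating `I`. -/
def AllowedWord (l : List Q.Arr) : Prop :=
  l.Chain' (fun a b => Q.tgt a = Q.src b ∧ ¬ rel a b)

/-- right maximal paths (of positive length) -/
def RightMaxWord (l : List Q.Arr) : Prop :=
  l ≠ [] ∧ AllowedWord rel l ∧ ∀ a : Q.Arr, ¬ AllowedWord rel (l ++ [a])

/-- left maximal paths (of positive length) -/
def LeftMaxWord (l : List Q.Arr) : Prop :=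
  l ≠ [] ∧ AllowedWord rel l ∧ ∀ a : Q.Arr, ¬ AllowedWord rel (a :: l)

/-- finite maximal paths -/
def FiniteMaxWord (l : List Q.Arr) : Prop := RightMaxWord rel l ∧ LeftMaxWord rel l

/-- a word is primitive if it is not a proper power -/
def PrimitiveWord (l : List Q.Arr) : Prop :=
  ∀ (l' : List Q.Arr) (n : ℕ), 2 ≤ n → l ≠ (List.replicate n l').flatten

/-- a primitive cycle `c` with `c² ∉ I`; these represent the infinite maximal paths `c^∞`. -/
def PrimCycleSq (c : List Q.Arr) : Prop :=
  c ≠ [] ∧ AllowedWord rel (c ++ c) ∧ wTgt? c = wSrc? c ∧ PrimitiveWord c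

/-- the maximal path `γ_α` containing `α` is infinite -/
def InfThrough (a : Q.Arr) : Prop := ∃ c, PrimCycleSq rel c ∧ a ∈ c

/-- the maximal path `γ_α` containing `α` is finite -/
def FinThrough (a : Q.Arr) : Prop := ∃ l, FiniteMaxWord rel l ∧ a ∈ l

/-- the rotation of the cycle `c` starting at the arrow `a`; when `a ∈ c` and `c` has no
duplicates this is the primitive cycle `γ_r(a)`. -/
def rotTo (c : List Q.Arr) (a : Q.Arr) : List Q.Arr :=
  c.dropWhile (fun b => b != a) ++ c.takeWhile (fun b => b != a)

/-- the relation set of the Koszul dual `A#`; its allowed words are the forbidden paths of `A`. -/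
def dualRel : Q.Arr → Q.Arr → Prop := fun a b => Q.tgt a = Q.src b ∧ ¬ rel a b

/-- a forbidden path of `A`, i.e. a path of the Koszul dual `A#` -/
def ForbiddenWord (l : List Q.Arr) : Prop := AllowedWord (dualRel rel) l

variable (Q)

/-- The defining conditions (i)-(iv) of a (locally) gentle algebra, in terms of the set of
length-two relations generating the ideal `I`: an algebra satisfying them is gentle if it
is finite dimensional and locally gentle otherwise. -/
structure IsGentleRel : Prop where
  indeg_le : ∀ v : Q.V, indeg Q v ≤ 2
  outdeg_le : ∀ v : Q.V, outdeg Q v ≤ 2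
  rel_comp : ∀ a b : Q.Arr, rel a b → Q.tgt a = Q.src b
  cond_ii : ∀ a b b' : Q.Arr, b ≠ b' → Q.tgt b = Q.src a → Q.tgt b' = Q.src a →
    Xor' (rel b a) (rel b' a)
  cond_iii : ∀ a b b' : Q.Arr, b ≠ b' → Q.tgt a = Q.src b → Q.tgt a = Q.src b' →
    Xor' (rel a b) (rel a b')

/-- `Q` is (as a quiver) the extended Dynkin quiver `Ã_n` (for `n = |Q₀| - 1`):
every vertex has in-degree and out-degree one. -/
def IsAtilde : Prop := ∀ v : Q.V, indeg Q v = 1 ∧ outdeg Q v = 1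

/-- paths of `Q`, including the stationary paths (`w = []`) at each vertex -/
structure Pth where
  s : Q.V
  w : List Q.Arr
  hs : ∀ a ∈ w.head?, Q.src a = s
  hc : Composable Q w

variable {Q}

/-- target of a path -/
def Pth.t (p : Pth Q) : Q.V := wTgtD p.w p.s

/-- length of a path -/
def Pth.len (p : Pth Q) : ℕ := p.w.length

/-- a basis path of `A = kQ/I` -/
def Pth.Allowed (p : Pth Q) : Prop := AllowedWord rel p.w

end LocGentle
namespace LocGentle

variable (k : Type) [Field k] (Q : Quiv) (rel : Q.Arr → Q.Arr → Prop)

/-- The defining relations presenting `A = kQ/I` as a quotient of the free algebra on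
the stationary paths (vertices) and arrows: the path algebra relations together with
the relations `αβ = 0` for the length-two paths `αβ` generating `I`. -/
inductive GARel : FreeAlgebra k (Q.V ⊕ Q.Arr) → FreeAlgebra k (Q.V ⊕ Q.Arr) → Prop
  | idem (v : Q.V) : GARel (FreeAlgebra.ι k (Sum.inl v) * FreeAlgebra.ι k (Sum.inl v))
      (FreeAlgebra.ι k (Sum.inl v))
  | orth (v w : Q.V) : v ≠ w → GARel (FreeAlgebra.ι k (Sum.inl v) * FreeAlgebra.ι k (Sum.inl w)) 0
  | unit : GARel (∑ v : Q.V, FreeAlgebra.ι k (Sum.inl v)) 1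
  | src_mul (a : Q.Arr) : GARel (FreeAlgebra.ι k (Sum.inl (Q.src a)) * FreeAlgebra.ι k (Sum.inr a))
      (FreeAlgebra.ι k (Sum.inr a))
  | mul_tgt (a : Q.Arr) : GARel (FreeAlgebra.ι k (Sum.inr a) * FreeAlgebra.ι k (Sum.inl (Q.tgt a)))
      (FreeAlgebra.ι k (Sum.inr a))
  | src_zero (v : Q.V) (a : Q.Arr) : v ≠ Q.src a →
      GARel (FreeAlgebra.ι k (Sum.inl v) * FreeAlgebra.ι k (Sum.inr a)) 0
  | tgt_zero (v : Q.V) (a : Q.Arr) : v ≠ Q.tgt a →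
      GARel (FreeAlgebra.ι k (Sum.inr a) * FreeAlgebra.ι k (Sum.inl v)) 0
  | rel_zero (a b : Q.Arr) : rel a b →
      GARel (FreeAlgebra.ι k (Sum.inr a) * FreeAlgebra.ι k (Sum.inr b)) 0

/-- The (locally) gentle algebra `A = kQ/I`. -/
abbrev GA := RingQuot (GARel k Q rel)

/-- the image in `A` of the stationary path at `v` -/
def vtx (v : Q.V) : GA k Q rel := RingQuot.mkAlgHom k _ (FreeAlgebra.ι k (Sum.inl v))

/-- the image in `A` of the arrow `a` -/
def arr (a : Q.Arr) : GA k Q rel := RingQuot.mkAlgHom k _ (FreeAlgebra.ι k (Sum.inr a))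

/-- the image in `A` of the word `l` (the product of its arrows) -/
def wordEl (l : List Q.Arr) : GA k Q rel := (l.map (arr k Q rel)).prod

variable {Q}

/-- the image in `A` of a path (a stationary path maps to the corresponding idempotent) -/
def Pth.el (p : Pth Q) : GA k Q rel := vtx k Q rel p.s * wordEl k Q rel p.w

variable (Q)

/-- the `n`-th graded component `A_n` of `A`, spanned by the images of paths of length `n` -/
def deg (n : ℕ) : Submodule k (GA k Q rel) :=
  Submodule.span k {x | ∃ p : Pth Q, p.Allowed rel ∧ p.len = n ∧ x = p.el k rel}

/-- the augmentation ideal `A₊` (as a `k`-submodule), spanned by paths of positive length -/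
def degPlus : Submodule k (GA k Q rel) :=
  Submodule.span k {x | ∃ p : Pth Q, p.Allowed rel ∧ 1 ≤ p.len ∧ x = p.el k rel}

/-- the Hilbert series of `A` (with integer coefficients) -/
def hilb : PowerSeries ℤ :=
  PowerSeries.mk fun n => (Module.finrank k (deg k Q rel n) : ℤ)

/-- the Hilbert series of `A` (with rational coefficients) -/
def hilbQ : PowerSeries ℚ :=
  PowerSeries.mk fun n => (Module.finrank k (deg k Q rel n) : ℚ)

/-- the number `k_n` of finite maximal paths of length at least `n` -/
def numFMP (n : ℕ) : ℕ := {l : List Q.Arr | FiniteMaxWord rel l ∧ n ≤ l.length}.ncard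

/-- the Gelfand-Kirillov dimension of `A`:
`limsup_n log (dim_k A_{≤ n}) / log n`. -/
def GKdim : ℝ :=
  Filter.limsup (fun n : ℕ =>
      Real.log (Module.finrank k ↥(⨆ i ∈ Finset.range (n + 1), deg k Q rel i)) / Real.log n)
    Filter.atTop

/-- the central element `m_γ` attached to the infinite maximal path `γ = c^∞`:
the sum over the arrows `α` of `c` of the primitive cycle `γ_r(α)` starting at `α`. -/
def mEl (c : List Q.Arr) : GA k Q rel := (c.map fun a => wordEl k Q rel (rotTo c a)).sum

/-- evaluation of a polynomial at `x ∈ A`; `polyEval k Q rel p x` is `p(x)`. -/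
def polyEval (p : Polynomial k) (x : GA k Q rel) : GA k Q rel :=
  Polynomial.eval₂ (algebraMap k (GA k Q rel)) x p

end LocGentle
namespace LocGentle

variable (k : Type) [Field k] (Q : Quiv) (rel : Q.Arr → Q.Arr → Prop)

/-! ### Two-sided ideals and primes -/

/-- a prime (two-sided) ideal -/
def IsPrimeTI (P : TwoSidedIdeal (GA k Q rel)) : Prop :=
  P ≠ ⊤ ∧ ∀ x y : GA k Q rel, (∀ a : GA k Q rel, x * a * y ∈ P) → x ∈ P ∨ y ∈ P

/-- the maximal ideal `𝔪_v` of `A` which does not contain `ε_v`: it is generated by the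
stationary paths at the other vertices together with all loops at `v`. -/
def mIdeal (v : Q.V) : TwoSidedIdeal (GA k Q rel) :=
  TwoSidedIdeal.span
    ({x | ∃ w : Q.V, w ≠ v ∧ x = vtx k Q rel w} ∪
     {x | ∃ a : Q.Arr, Q.src a = v ∧ Q.tgt a = v ∧ x = arr k Q rel a})

/-- the ideal `J_γ` corresponding to the infinite maximal path `γ = c^∞`, generated by
all arrows lying on `γ` -/
def Jgamma (c : List Q.Arr) : TwoSidedIdeal (GA k Q rel) :=
  TwoSidedIdeal.span {x | ∃ a ∈ c, x = arr k Q rel a}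

/-- the left annihilator of `J_γ` -/
def annJ (c : List Q.Arr) : Set (GA k Q rel) :=
  {x | ∀ y ∈ Jgamma k Q rel c, x * y = 0}

/-! ### The simple modules `S(v)`, and `Ext` groups -/

/-- the algebra map `A → k` corresponding to the vertex `v` (projection onto the
coefficient of `ε_v`) -/
def vtxHomAux (v : Q.V) : FreeAlgebra k (Q.V ⊕ Q.Arr) →ₐ[k] k :=
  FreeAlgebra.lift k (Sum.elim (fun w => if w = v then (1 : k) else 0) (fun _ => 0))

theorem vtxHomAux_rel (v : Q.V) : ∀ ⦃x y⦄, GARel k Q rel x y →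
    vtxHomAux k Q v x = vtxHomAux k Q v y := by
  intro x y h
  cases h with
  | idem w =>
      simp only [vtxHomAux, map_mul, FreeAlgebra.lift_ι_apply, Sum.elim_inl]
      split_ifs <;> simp
  | orth w w' hne =>
      simp only [vtxHomAux, map_mul, FreeAlgebra.lift_ι_apply, Sum.elim_inl, map_zero]
      split_ifs with h1 h2 <;> first | (exact absurd (h1.trans h2.symm) hne) | simp
  | unit =>
      simp only [vtxHomAux, map_sum, FreeAlgebra.lift_ι_apply, Sum.elim_inl, map_one]
      simp [Finset.sum_ite_eq' Finset.univ v (fun _ => (1:k))]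
  | src_mul a =>
      simp [vtxHomAux, map_mul, FreeAlgebra.lift_ι_apply]
  | mul_tgt a =>
      simp [vtxHomAux, map_mul, FreeAlgebra.lift_ι_apply]
  | src_zero w a hw =>
      simp [vtxHomAux, map_mul, FreeAlgebra.lift_ι_apply]
  | tgt_zero w a hw =>
      simp [vtxHomAux, map_mul, FreeAlgebra.lift_ι_apply]
  | rel_zero a b hab =>
      simp [vtxHomAux, map_mul, FreeAlgebra.lift_ι_apply]

/-- the ring map `A → k` corresponding to the vertex `v` -/
def vtxHom (v : Q.V) : GA k Q rel →+* k :=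
  RingQuot.lift ⟨(vtxHomAux k Q v).toRingHom, fun _ _ h => vtxHomAux_rel k Q rel v h⟩

/-- the ring map `A → k^{Q₀}` with kernel `A₊` -/
def SHom : GA k Q rel →+* (Q.V → k) := Pi.ringHom fun v => vtxHom k Q rel v

/-- the graded simple right `A`-module `S(v)` at the vertex `v` -/
def SvModR (v : Q.V) : ModuleCat (GA k Q rel)ᵐᵒᵖ :=
  @ModuleCat.of _ _ k _
    (Module.compHom k ((vtxHom k Q rel v).fromOpposite (fun _ _ => mul_comm _ _)))

/-- the graded simple left `A`-module `S(v)` at the vertex `v` -/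
def SvModL (v : Q.V) : ModuleCat (GA k Q rel) :=
  @ModuleCat.of _ _ k _ (Module.compHom k (vtxHom k Q rel v))

/-- `S = A/A₊ ≅ ⊕_v S(v)` as a right `A`-module -/
def SModR : ModuleCat (GA k Q rel)ᵐᵒᵖ :=
  @ModuleCat.of _ _ (Q.V → k) _
    (Module.compHom _ ((SHom k Q rel).fromOpposite (fun _ _ => mul_comm _ _)))

/-- `S = A/A₊` as a left `A`-module -/
def SModL : ModuleCat (GA k Q rel) :=
  @ModuleCat.of _ _ (Q.V → k) _ (Module.compHom _ (SHom k Q rel))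

/-- `A` as a right module over itself -/
def AModR : ModuleCat (GA k Q rel)ᵐᵒᵖ := ModuleCat.of _ (GA k Q rel)

/-- `A` as a left module over itself -/
def AModL : ModuleCat (GA k Q rel) := ModuleCat.of _ (GA k Q rel)

/-- nonvanishing of `Ext^i(M, N)` for modules over a ring `R` -/
def extNZ {R : Type} [Ring R] (i : ℕ) (M N : ModuleCat R) : Prop :=
  ¬ Subsingleton (((Ext ℤ (ModuleCat R) i).obj (Opposite.op M)).obj N)

/-- nonvanishing of `Ext^i_A(S(v), A)` in right `A`-modules.  (For the Noetherian graded
algebra `A` with the finitely generated modules `S(v)` and `A` this agrees with the graded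
`Ext`-group, summed over all shifts, used in the paper.) -/
def extSvNZ (i : ℕ) (v : Q.V) : Prop := extNZ i (SvModR k Q rel v) (AModR k Q rel)

/-- nonvanishing of `Ext^i_A(S, A)` in right `A`-modules -/
def extSNZ (i : ℕ) : Prop := extNZ i (SModR k Q rel) (AModR k Q rel)

/-- the depth of `A`: `min { i : Ext^i_A(S, A) ≠ 0 }` -/
def depth : ℕ∞ := sInf {n : ℕ∞ | ∃ i : ℕ, n = i ∧ extSNZ k Q rel i}

/-- the right self-injective dimension of `A`:
`sup { i : Ext^i(M, A) ≠ 0 for some right module M }` -/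
def rInjDim : ℕ∞ :=
  sSup {n : ℕ∞ | ∃ (i : ℕ) (M : ModuleCat.{0} (GA k Q rel)ᵐᵒᵖ), n = i ∧ extNZ i M (AModR k Q rel)}

/-- the left self-injective dimension of `A` -/
def lInjDim : ℕ∞ :=
  sSup {n : ℕ∞ | ∃ (i : ℕ) (M : ModuleCat.{0} (GA k Q rel)), n = i ∧ extNZ i M (AModL k Q rel)}

/-- the right global dimension of `A`: `sup { i : Ext^i(M, N) ≠ 0 }` over right modules -/
def rGlDim : ℕ∞ :=
  sSup {n : ℕ∞ | ∃ (i : ℕ) (M N : ModuleCat.{0} (GA k Q rel)ᵐᵒᵖ), n = i ∧ extNZ i M N}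

/-- the left global dimension of `A` -/
def lGlDim : ℕ∞ :=
  sSup {n : ℕ∞ | ∃ (i : ℕ) (M N : ModuleCat.{0} (GA k Q rel)), n = i ∧ extNZ i M N}

end LocGentle
namespace LocGentle

section Words

variable {Q : Quiv} {rel : Q.Arr → Q.Arr → Prop}

/-- `b` may follow `a` in an allowed word, i.e. `ab` is a nonzero path of length two. -/
def Follows (rel : Q.Arr → Q.Arr → Prop) (a b : Q.Arr) : Prop :=
  Q.tgt a = Q.src b ∧ ¬ rel a b

/-- `a` lies on a cycle all of whose powers are allowed words. -/
def Recurrent (rel : Q.Arr → Q.Arr → Prop) (a : Q.Arr) : Prop :=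
  Relation.TransGen (Follows rel) a a

theorem Follows.right_unique (hg : IsGentleRel Q rel) {a b c : Q.Arr}
    (hb : Follows rel a b) (hc : Follows rel a c) : b = c := by
  by_contra hne
  rcases hg.cond_iii a b c hne hb.1 hc.1 with h | h
  · exact hb.2 h.1
  · exact hc.2 h.1

theorem Follows.left_unique (hg : IsGentleRel Q rel) {a b c : Q.Arr}
    (ha : Follows rel a c) (hb : Follows rel b c) : a = b := by
  by_contra hne
  rcases hg.cond_ii c a b hne ha.1 hb.1 with h | h
  · exact ha.2 h.1
  · exact hb.2 h.1

theorem Follows.recurrent_iff (hg : IsGentleRel Q rel) {a b : Q.Arr} (h : Follows rel a b) :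
    Recurrent rel a ↔ Recurrent rel b := by
  constructor
  · intro ha
    obtain ⟨c, hac, hca⟩ := Relation.TransGen.head'_iff.1 ha
    obtain rfl := h.right_unique hg hac
    exact Relation.TransGen.tail' hca h
  · intro hb
    obtain ⟨c, hbc, hcb⟩ := Relation.TransGen.tail'_iff.1 hb
    obtain rfl := h.left_unique hg hcb
    exact Relation.TransGen.head' h hbc

theorem recurrent_iff_of_transGen (hg : IsGentleRel Q rel) {a b : Q.Arr}
    (h : Relation.TransGen (Follows rel) a b) : Recurrent rel a ↔ Recurrent rel b := by
  induction h with
  | single h => exact h.recurrent_iff hg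
  | tail _ h ih => exact ih.trans (h.recurrent_iff hg)

theorem Recurrent.transGen_symm (hg : IsGentleRel Q rel) {a b : Q.Arr} (ha : Recurrent rel a)
    (h : Relation.ReflTransGen (Follows rel) a b) : Relation.TransGen (Follows rel) b a := by
  induction h with
  | refl => exact ha
  | tail _ h ih =>
    obtain ⟨c, hc, hca⟩ := Relation.TransGen.head'_iff.1 ih
    obtain rfl := h.right_unique hg hc
    exact Relation.TransGen.trans_right hca ha

theorem AllowedWord.pairwise {l : List Q.Arr} (hl : AllowedWord rel l) :
    l.Pairwise (Relation.TransGen (Follows rel)) :=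
  List.isChain_iff_pairwise.1 (List.IsChain.imp (fun _ _ h => Relation.TransGen.single h) hl)

theorem AllowedWord.recurrent_iff (hg : IsGentleRel Q rel) {l : List Q.Arr}
    (hl : AllowedWord rel l) {a b : Q.Arr} (ha : a ∈ l) (hb : b ∈ l) :
    Recurrent rel a ↔ Recurrent rel b :=
  have : Std.Symm fun a b => Recurrent rel a ↔ Recurrent rel b := ⟨fun _ _ h => h.symm⟩
  List.Pairwise.forall_of_forall (R := fun a b => Recurrent rel a ↔ Recurrent rel b)
    (fun _ _ => Iff.rfl)
    (hl.pairwise.imp fun h => recurrent_iff_of_transGen hg h) ha hb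

theorem AllowedWord.length_le (hg : IsGentleRel Q rel) {l : List Q.Arr}
    (hl : AllowedWord rel l) {a : Q.Arr} (ha : a ∈ l) (hrec : ¬ Recurrent rel a) :
    l.length ≤ Fintype.card Q.Arr := by
  refine List.Nodup.length_le_card (List.Pairwise.imp_of_mem ?_ hl.pairwise)
  rintro x y hx - hxy rfl
  exact hrec ((hl.recurrent_iff hg ha hx).2 hxy)

/-- The arrows whose maximal path is finite are the non-recurrent ones. -/
theorem finThrough_iff (hg : IsGentleRel Q rel) (a : Q.Arr) :
    FinThrough rel a ↔ ¬ Recurrent rel a := by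
  constructor
  · rintro ⟨l, ⟨⟨hne, hl, hmax⟩, -⟩, ha⟩ hrec
    have hlast := (hl.recurrent_iff hg ha (List.getLast_mem hne)).1 hrec
    obtain ⟨b, hb, -⟩ := Relation.TransGen.head'_iff.1 hlast
    refine hmax b (List.isChain_append.2 ⟨hl, List.isChain_singleton _, ?_⟩)
    intro x hx y hy
    rw [List.getLast?_eq_getLast_of_ne_nil hne] at hx
    simp only [Option.mem_def, Option.some.injEq, List.head?_cons] at hx hy
    subst hx hy
    exact hb
  · intro hrec
    classical
    let p : ℕ → Prop := fun n => ∃ l : List Q.Arr, AllowedWord rel l ∧ a ∈ l ∧ l.length = n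
    have hle : ∀ l : List Q.Arr, AllowedWord rel l → a ∈ l →
        l.length ≤ Nat.findGreatest p (Fintype.card Q.Arr) := fun l hl ha =>
      Nat.le_findGreatest (hl.length_le hg ha hrec) ⟨l, hl, ha, rfl⟩
    have hs : AllowedWord rel [a] := List.isChain_singleton _
    obtain ⟨l, hl, ha, hlen⟩ : p (Nat.findGreatest p (Fintype.card Q.Arr)) :=
      Nat.findGreatest_spec (hs.length_le hg (List.mem_singleton_self a) hrec)
        ⟨[a], hs, List.mem_singleton_self a, rfl⟩
    have hne : l ≠ [] := List.ne_nil_of_mem ha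
    refine ⟨l, ⟨⟨hne, hl, fun b hb => ?_⟩, ⟨hne, hl, fun b hb => ?_⟩⟩, ha⟩
    · have := hle _ hb (List.mem_append_left _ ha)
      rw [List.length_append, List.length_singleton] at this
      omega
    · have := hle _ hb (List.mem_cons_of_mem _ ha)
      rw [List.length_cons] at this
      omega

end Words

section Relations

variable {k : Type} [Field k] {Q : Quiv} {rel : Q.Arr → Q.Arr → Prop}

theorem mkAlgHom_eq_of_rel {x y : FreeAlgebra k (Q.V ⊕ Q.Arr)} (h : GARel k Q rel x y) :
    RingQuot.mkAlgHom k (GARel k Q rel) x = RingQuot.mkAlgHom k (GARel k Q rel) y :=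
  RingQuot.mkAlgHom_rel k h

theorem vtx_mul_vtx (v w : Q.V) :
    vtx k Q rel v * vtx k Q rel w = if v = w then vtx k Q rel w else 0 := by
  split_ifs with h
  · subst h
    simpa [vtx, arr] using mkAlgHom_eq_of_rel (rel := rel) (GARel.idem (k := k) v)
  · simpa [vtx, arr] using mkAlgHom_eq_of_rel (rel := rel) (GARel.orth (k := k) v w h)

theorem sum_vtx : ∑ v, vtx k Q rel v = 1 := by
  simpa [vtx, arr] using mkAlgHom_eq_of_rel (GARel.unit (k := k) (Q := Q) (rel := rel))

theorem vtx_mul_arr (v : Q.V) (a : Q.Arr) :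
    vtx k Q rel v * arr k Q rel a = if v = Q.src a then arr k Q rel a else 0 := by
  split_ifs with h
  · subst h
    simpa [vtx, arr] using mkAlgHom_eq_of_rel (rel := rel) (GARel.src_mul (k := k) a)
  · simpa [vtx, arr] using mkAlgHom_eq_of_rel (rel := rel) (GARel.src_zero (k := k) v a h)

theorem arr_mul_vtx (v : Q.V) (a : Q.Arr) :
    arr k Q rel a * vtx k Q rel v = if v = Q.tgt a then arr k Q rel a else 0 := by
  split_ifs with h
  · subst h
    simpa [vtx, arr] using mkAlgHom_eq_of_rel (rel := rel) (GARel.mul_tgt (k := k) a)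
  · simpa [vtx, arr] using mkAlgHom_eq_of_rel (rel := rel) (GARel.tgt_zero (k := k) v a h)

theorem arr_mul_arr_eq_zero {a b : Q.Arr} (h : ¬ Follows rel a b) :
    arr k Q rel a * arr k Q rel b = 0 := by
  by_cases hab : Q.tgt a = Q.src b
  · have hrel : rel a b := by
      by_contra hn
      exact h ⟨hab, hn⟩
    simpa [vtx, arr] using mkAlgHom_eq_of_rel (GARel.rel_zero (k := k) a b hrel)
  · have h1 := arr_mul_vtx (k := k) (rel := rel) (Q.tgt a) a
    rw [if_pos rfl] at h1
    rw [← h1, mul_assoc, vtx_mul_arr, if_neg hab, mul_zero]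

/-- A subspace of `A` stable under left multiplication by the vertices and the arrows is a
left ideal. -/
theorem mul_mem_of_generators (M : Submodule k (GA k Q rel))
    (hv : ∀ v, ∀ m ∈ M, vtx k Q rel v * m ∈ M) (ha : ∀ a, ∀ m ∈ M, arr k Q rel a * m ∈ M)
    (x m : GA k Q rel) (hm : m ∈ M) : x * m ∈ M := by
  obtain ⟨y, rfl⟩ := RingQuot.mkAlgHom_surjective k (GARel k Q rel) x
  induction y using FreeAlgebra.induction generalizing m with
  | grade0 r =>
    rw [AlgHom.commutes, ← Algebra.smul_def]
    exact M.smul_mem r hm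
  | grade1 i =>
    rcases i with v | a
    · exact hv v m hm
    · exact ha a m hm
  | mul y z hy hz =>
    rw [map_mul, mul_assoc]
    exact hy _ (hz _ hm)
  | add y z hy hz =>
    rw [map_add, add_mul]
    exact M.add_mem (hy _ hm) (hz _ hm)

/-- A non-recurrent arrow `a` satisfies `aAa = 0`. -/
theorem arr_mul_mul_arr_eq_zero {a : Q.Arr} (h : ¬ Recurrent rel a) (x : GA k Q rel) :
    arr k Q rel a * x * arr k Q rel a = 0 := by
  let M : Submodule k (GA k Q rel) := Submodule.span k
    {y | ∃ b z, Relation.ReflTransGen (Follows rel) b a ∧ y = arr k Q rel b * z}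
  have hgen : ∀ g : GA k Q rel,
      (∀ b z, Relation.ReflTransGen (Follows rel) b a → g * (arr k Q rel b * z) ∈ M) →
      ∀ m ∈ M, g * m ∈ M := by
    intro g hg m hm
    induction hm using Submodule.span_induction with
    | mem m hm =>
      obtain ⟨b, z, hb, rfl⟩ := hm
      exact hg b z hb
    | zero => rw [mul_zero]; exact M.zero_mem
    | add _ _ _ _ h1 h2 => rw [mul_add]; exact M.add_mem h1 h2
    | smul c _ _ h1 => rw [mul_smul_comm]; exact M.smul_mem c h1
  have hM : x * arr k Q rel a ∈ M := by
    refine mul_mem_of_generators M (fun v => hgen _ fun b z hb => ?_)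
      (fun c => hgen _ fun b z hb => ?_) x _
      (Submodule.subset_span ⟨a, 1, Relation.ReflTransGen.refl, (mul_one _).symm⟩)
    · rw [← mul_assoc, vtx_mul_arr]
      split_ifs
      · exact Submodule.subset_span ⟨b, z, hb, rfl⟩
      · rw [zero_mul]; exact M.zero_mem
    · by_cases hcb : Follows rel c b
      · exact Submodule.subset_span ⟨c, _, hb.head hcb, rfl⟩
      · rw [← mul_assoc, arr_mul_arr_eq_zero hcb, zero_mul]
        exact M.zero_mem
  rw [mul_assoc]
  generalize x * arr k Q rel a = m at hM
  induction hM using Submodule.span_induction with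
  | mem m hm =>
    obtain ⟨b, z, hb, rfl⟩ := hm
    rw [← mul_assoc, arr_mul_arr_eq_zero fun hab => h (Relation.TransGen.head' hab hb), zero_mul]
  | zero => exact mul_zero _
  | add _ _ _ _ h1 h2 => rw [mul_add, h1, h2, add_zero]
  | smul c _ _ h1 => rw [mul_smul_comm, h1, smul_zero]

/-- The algebra homomorphism out of `A` determined by the images of the vertices and the
arrows. -/
def liftGA {B : Type} [Ring B] [Algebra k B] (e : Q.V → B) (f : Q.Arr → B)
    (h : ∀ ⦃x y⦄, GARel k Q rel x y →
      FreeAlgebra.lift k (Sum.elim e f) x = FreeAlgebra.lift k (Sum.elim e f) y) :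
    GA k Q rel →ₐ[k] B :=
  RingQuot.liftAlgHom k ⟨FreeAlgebra.lift k (Sum.elim e f), h⟩

@[simp]
theorem liftGA_vtx {B : Type} [Ring B] [Algebra k B] (e : Q.V → B) (f : Q.Arr → B)
    (h : ∀ ⦃x y⦄, GARel k Q rel x y →
      FreeAlgebra.lift k (Sum.elim e f) x = FreeAlgebra.lift k (Sum.elim e f) y) (v : Q.V) :
    liftGA e f h (vtx k Q rel v) = e v := by
  simp [liftGA, vtx]

@[simp]
theorem liftGA_arr {B : Type} [Ring B] [Algebra k B] (e : Q.V → B) (f : Q.Arr → B)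
    (h : ∀ ⦃x y⦄, GARel k Q rel x y →
      FreeAlgebra.lift k (Sum.elim e f) x = FreeAlgebra.lift k (Sum.elim e f) y) (a : Q.Arr) :
    liftGA e f h (arr k Q rel a) = f a := by
  simp [liftGA, arr]

end Relations

section Representations

variable (k : Type) [Field k] {Q : Quiv} (rel : Q.Arr → Q.Arr → Prop)

/-- The one-dimensional representation of `A` at the vertex `v`, as an algebra homomorphism. -/
def vertexHom (v : Q.V) : GA k Q rel →ₐ[k] k :=
  liftGA (fun w => if w = v then (1 : k) else 0) (fun _ => 0) (vtxHomAux_rel k Q rel v)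

/-- The two-dimensional representation of `A` in which the arrow `a` acts by the matrix unit
`E₀₁` and all other arrows act by zero. -/
def arrowHom (a : Q.Arr) : GA k Q rel →ₐ[k] Matrix (Fin 2) (Fin 2) k :=
  liftGA
    (fun v => !![if v = Q.src a then 1 else 0, 0; 0, if v = Q.tgt a then 1 else 0])
    (fun b => if b = a then !![0, 1; 0, 0] else 0)
    (by
      intro x y h
      cases h with
      | idem v =>
        ext i j
        fin_cases i <;> fin_cases j <;> simp <;> split_ifs <;> rfl
      | orth v w hne =>
        ext i j
        fin_cases i <;> fin_cases j <;> simp <;> split_ifs <;> simp_all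
      | unit =>
        ext i j
        fin_cases i <;> fin_cases j <;> simp [Matrix.sum_apply]
      | src_mul b =>
        by_cases hb : b = a
        · subst hb
          ext i j
          fin_cases i <;> fin_cases j <;> simp <;> split_ifs <;> rfl
        · simp [hb]
      | mul_tgt b =>
        by_cases hb : b = a
        · subst hb
          ext i j
          fin_cases i <;> fin_cases j <;> simp
        · simp [hb]
      | src_zero v b hv =>
        by_cases hb : b = a
        · subst hb
          ext i j
          fin_cases i <;> fin_cases j <;> simp [hv] <;> split_ifs <;> rfl
        · simp [hb]
      | tgt_zero v b hv =>
        by_cases hb : b = a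
        · subst hb
          ext i j
          fin_cases i <;> fin_cases j <;> simp [hv]
        · simp [hb]
      | rel_zero b c _ =>
        by_cases hb : b = a <;> by_cases hc : c = a <;> simp [hb, hc]
        ext i j
        fin_cases i <;> fin_cases j <;> rfl)

theorem arr_ne_zero (a : Q.Arr) : arr k Q rel a ≠ 0 := by
  intro h
  have h1 := congrArg (fun x => arrowHom k rel a x 0 1) h
  simp [arrowHom] at h1

open Classical in
/-- The representation of `A` over `k[X]` with basis a set `O` of arrows, in which each arrow
`a ∈ O` acts by `X` times the matrix units `E_{a,b}` for the `b ∈ O` that may follow `a`. -/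
def orbitHom (O : Q.Arr → Prop) :
    GA k Q rel →ₐ[k] Matrix {a // O a} {a // O a} (Polynomial k) :=
  liftGA
    (fun v => Matrix.diagonal fun i => if v = Q.src i.1 then 1 else 0)
    (fun b => Matrix.of fun i j => if i.1 = b ∧ Follows rel b j.1 then Polynomial.X else 0)
    (by
      intro x y h
      cases h with
      | idem v => simp
      | orth v w hne =>
        simp only [map_mul, FreeAlgebra.lift_ι_apply, Sum.elim_inl, map_zero,
          Matrix.diagonal_mul_diagonal]
        rw [← Matrix.diagonal_zero]
        congr 1
        ext1 i
        split_ifs with h1 h2 <;> simp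
        exact hne (h1.trans h2.symm)
      | unit =>
        ext1 i j
        by_cases hij : i = j
        · subst hij
          simp [Matrix.sum_apply]
        · simp [Matrix.sum_apply, hij]
      | src_mul b =>
        ext1 i j
        simp only [map_mul, FreeAlgebra.lift_ι_apply, Sum.elim_inl, Sum.elim_inr,
          Matrix.diagonal_mul, Matrix.of_apply]
        by_cases hi : i.1 = b <;> simp [hi]
      | mul_tgt b =>
        ext1 i j
        simp only [map_mul, FreeAlgebra.lift_ι_apply, Sum.elim_inl, Sum.elim_inr,
          Matrix.mul_diagonal, Matrix.of_apply]
        by_cases hi : Follows rel b j.1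
        · simp [hi.1]
        · simp [hi]
      | src_zero v b hv =>
        ext1 i j
        simp only [map_mul, FreeAlgebra.lift_ι_apply, Sum.elim_inl, Sum.elim_inr,
          Matrix.diagonal_mul, Matrix.of_apply, map_zero, Matrix.zero_apply]
        by_cases hi : i.1 = b <;> simp [hi, hv]
      | tgt_zero v b hv =>
        ext1 i j
        simp only [map_mul, FreeAlgebra.lift_ι_apply, Sum.elim_inl, Sum.elim_inr,
          Matrix.mul_diagonal, Matrix.of_apply, map_zero, Matrix.zero_apply]
        by_cases hi : Follows rel b j.1
        · simp [← hi.1, hv]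
        · simp [hi]
      | rel_zero b c hbc =>
        ext1 i j
        simp only [map_mul, FreeAlgebra.lift_ι_apply, Sum.elim_inr, map_zero, Matrix.zero_apply,
          Matrix.mul_apply, Matrix.of_apply]
        refine Finset.sum_eq_zero fun l _ => ?_
        by_cases hl : l.1 = c
        · have : ¬ Follows rel b l.1 := fun h => h.2 (hl ▸ hbc)
          simp [this]
        · simp [hl])

@[simp]
theorem vertexHom_vtx (v w : Q.V) :
    vertexHom k rel v (vtx k Q rel w) = if w = v then 1 else 0 :=
  liftGA_vtx _ _ _ _

@[simp]
theorem vertexHom_arr (v : Q.V) (a : Q.Arr) : vertexHom k rel v (arr k Q rel a) = 0 :=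
  liftGA_arr _ _ _ _

open Classical in
theorem orbitHom_vtx (O : Q.Arr → Prop) (v : Q.V) :
    orbitHom k rel O (vtx k Q rel v) =
      Matrix.diagonal fun i : {a // O a} => if v = Q.src i.1 then 1 else 0 :=
  liftGA_vtx _ _ _ _

open Classical in
theorem orbitHom_arr (O : Q.Arr → Prop) (b : Q.Arr) :
    orbitHom k rel O (arr k Q rel b) = Matrix.of fun i j : {a // O a} =>
      if i.1 = b ∧ Follows rel b j.1 then Polynomial.X else 0 :=
  liftGA_arr _ _ _ _

open Classical in
theorem orbitHom_arr_of_not {O : Q.Arr → Prop} {b : Q.Arr} (hb : ¬ O b) :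
    orbitHom k rel O (arr k Q rel b) = 0 := by
  ext1 i j
  have : i.1 ≠ b := fun h => hb (h ▸ i.2)
  simp [orbitHom_arr, this]

open Classical in
theorem orbitHom_arr_eq_single (hg : IsGentleRel Q rel) {O : Q.Arr → Prop} {i j : {a // O a}}
    (h : Follows rel i.1 j.1) :
    orbitHom k rel O (arr k Q rel i.1) = Matrix.single i j Polynomial.X := by
  ext1 p q
  simp only [orbitHom_arr, Matrix.of_apply, Matrix.single_apply]
  refine if_congr ⟨fun hpq => ⟨Subtype.ext hpq.1.symm, Subtype.ext (h.right_unique hg hpq.2)⟩, ?_⟩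
    rfl rfl
  rintro ⟨rfl, rfl⟩
  exact ⟨rfl, h⟩

open Classical in
theorem exists_orbitHom_eq_single (hg : IsGentleRel Q rel) {O : Q.Arr → Prop}
    (hO : ∀ b c, O b → Follows rel b c → O c) (i : {a // O a}) {b : Q.Arr}
    (h : Relation.TransGen (Follows rel) i.1 b) :
    ∃ (hb : O b) (w : GA k Q rel) (m : ℕ),
      orbitHom k rel O w = Matrix.single i ⟨b, hb⟩ (Polynomial.X ^ m) := by
  induction h with
  | single h =>
    exact ⟨hO _ _ i.2 h, arr k Q rel i.1, 1, by
      rw [pow_one, orbitHom_arr_eq_single k rel hg (j := ⟨_, hO _ _ i.2 h⟩) h]⟩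
  | @tail b c _ h ih =>
    obtain ⟨hb, w, m, hw⟩ := ih
    exact ⟨hO _ _ hb h, w * arr k Q rel b, m + 1, by
      rw [map_mul, hw, orbitHom_arr_eq_single k rel hg (i := ⟨b, hb⟩) (j := ⟨c, hO _ _ hb h⟩) h,
        Matrix.single_mul_single_same, pow_succ]⟩

/-- The arrows that can be reached from `a` along allowed words. -/
abbrev Orbit (a : Q.Arr) : Q.Arr → Prop := Relation.ReflTransGen (Follows rel) a

theorem Recurrent.of_orbit {rel : Q.Arr → Q.Arr → Prop} (hg : IsGentleRel Q rel) {a b : Q.Arr}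
    (ha : Recurrent rel a) (hb : Orbit rel a b) : Recurrent rel b :=
  Relation.TransGen.trans_left (ha.transGen_symm hg hb) hb

open Classical in
/-- The kernel of the representation of `A` on the orbit of `a`. -/
def orbitIdeal (a : Q.Arr) : TwoSidedIdeal (GA k Q rel) :=
  TwoSidedIdeal.ker (orbitHom k rel (Orbit rel a))

open Classical in
theorem mem_orbitIdeal {a : Q.Arr} {x : GA k Q rel} :
    x ∈ orbitIdeal k rel a ↔ orbitHom k rel (Orbit rel a) x = 0 :=
  TwoSidedIdeal.mem_ker _

theorem arr_mem_orbitIdeal {a b : Q.Arr} (h : ¬ Orbit rel a b) :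
    arr k Q rel b ∈ orbitIdeal k rel a :=
  (mem_orbitIdeal k rel).2 (orbitHom_arr_of_not k rel h)

open Classical in
theorem isPrimeTI_orbitIdeal (hg : IsGentleRel Q rel) {a : Q.Arr} (ha : Recurrent rel a) :
    IsPrimeTI k Q rel (orbitIdeal k rel a) := by
  constructor
  · intro htop
    have h1 : (1 : GA k Q rel) ∈ orbitIdeal k rel a :=
      htop ▸ trivial
    rw [mem_orbitIdeal, map_one] at h1
    have h2 := congrFun (congrFun h1 ⟨a, Relation.ReflTransGen.refl⟩)
      ⟨a, Relation.ReflTransGen.refl⟩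
    simp at h2
  · intro x y hxy
    simp only [mem_orbitIdeal] at hxy ⊢
    by_contra! hne
    obtain ⟨hx, hy⟩ := hne
    obtain ⟨i, j, hij⟩ : ∃ i j, orbitHom k rel (Orbit rel a) x i j ≠ 0 := by
      by_contra! h
      exact hx (Matrix.ext h)
    obtain ⟨p, q, hpq⟩ : ∃ p q, orbitHom k rel (Orbit rel a) y p q ≠ 0 := by
      by_contra! h
      exact hy (Matrix.ext h)
    obtain ⟨hb, w, m, hw⟩ := exists_orbitHom_eq_single k rel hg
      (fun b c hb hbc => Relation.ReflTransGen.tail hb hbc) j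
      (Relation.TransGen.trans_left (ha.transGen_symm hg j.2) p.2)
    have h := congrFun (congrFun (hxy w) i) q
    rw [map_mul, map_mul, hw, mul_assoc, Matrix.mul_apply,
      Finset.sum_eq_single j (fun l _ hl => by
        rw [Matrix.single_mul_apply_of_ne _ _ _ _ _ hl, mul_zero])
      (fun hj => absurd (Finset.mem_univ j) hj),
      Matrix.single_mul_apply_same, Matrix.zero_apply] at h
    exact mul_ne_zero hij (mul_ne_zero (pow_ne_zero m Polynomial.X_ne_zero) hpq) h

theorem isPrimeTI_ker_vertexHom (v : Q.V) :
    IsPrimeTI k Q rel (TwoSidedIdeal.ker (vertexHom k rel v)) := by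
  constructor
  · intro htop
    have h1 : (1 : GA k Q rel) ∈ TwoSidedIdeal.ker (vertexHom k rel v) := htop ▸ trivial
    rw [TwoSidedIdeal.mem_ker, map_one] at h1
    exact one_ne_zero h1
  · intro x y hxy
    have h := hxy 1
    simp only [TwoSidedIdeal.mem_ker, mul_one, map_mul] at h ⊢
    exact mul_eq_zero.1 h

end Representations

section Decomposition

variable (k : Type) [Field k] {Q : Quiv} (rel : Q.Arr → Q.Arr → Prop)

open Classical in
/-- The arrow following `a` in an allowed word, if there is one. -/
def next (a : Q.Arr) : Q.Arr := if h : ∃ b, Follows rel a b then h.choose else a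

variable {rel} in
theorem Follows.next_eq (hg : IsGentleRel Q rel) {a b : Q.Arr} (h : Follows rel a b) :
    next rel a = b := by
  have hex : ∃ b, Follows rel a b := ⟨b, h⟩
  rw [next, dif_pos hex]
  exact hex.choose_spec.right_unique hg h

variable {rel} in
theorem Recurrent.follows_next (hg : IsGentleRel Q rel) {a : Q.Arr} (ha : Recurrent rel a) :
    Follows rel a (next rel a) := by
  obtain ⟨b, hab, -⟩ := Relation.TransGen.head'_iff.1 ha
  rwa [hab.next_eq hg]

/-- The path of length `n + 1` starting with the arrow `a`. -/
def pathEl : Q.Arr → ℕ → GA k Q rel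
  | a, 0 => arr k Q rel a
  | a, n + 1 => arr k Q rel a * pathEl (next rel a) n

theorem exists_pathEl_eq_arr_mul (a : Q.Arr) (n : ℕ) :
    ∃ z, pathEl k rel a n = arr k Q rel a * z := by
  cases n with
  | zero => exact ⟨1, (mul_one _).symm⟩
  | succ n => exact ⟨_, rfl⟩

/-- The vertices together with the nonzero paths along recurrent arrows. -/
def recurrentPath : Q.V ⊕ {a // Recurrent rel a} × ℕ → GA k Q rel :=
  Sum.elim (vtx k Q rel) fun p => pathEl k rel p.1.1 p.2

/-- Modulo an ideal containing the non-recurrent arrows, `A` is spanned by the vertices and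
the paths along recurrent arrows. -/
theorem exists_eq_add_linearCombination (hg : IsGentleRel Q rel)
    (I : TwoSidedIdeal (GA k Q rel)) (hI : ∀ a, ¬ Recurrent rel a → arr k Q rel a ∈ I)
    (x : GA k Q rel) :
    ∃ y ∈ I, ∃ c : Q.V ⊕ {a // Recurrent rel a} × ℕ →₀ k,
      x = y + Finsupp.linearCombination k (recurrentPath k rel) c := by
  let N : Submodule k (GA k Q rel) :=
    { carrier := I
      add_mem' := I.add_mem
      zero_mem' := I.zero_mem
      smul_mem' := fun c y hy => by
        rw [Algebra.smul_def]
        exact I.mul_mem_left _ _ hy }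
  let M := N ⊔ Submodule.span k (Set.range (recurrentPath k rel))
  have hN : ∀ y ∈ I, y ∈ M := fun y hy => Submodule.mem_sup_left (show y ∈ N from hy)
  have hR : ∀ i, recurrentPath k rel i ∈ M := fun i =>
    Submodule.mem_sup_right (Submodule.subset_span ⟨i, rfl⟩)
  have hgen : ∀ g : GA k Q rel, (∀ i, g * recurrentPath k rel i ∈ M) →
      ∀ m ∈ M, g * m ∈ M := by
    intro g hgi m hm
    obtain ⟨y, hy, z, hz, rfl⟩ := Submodule.mem_sup.1 hm
    rw [mul_add]
    refine M.add_mem (hN _ (I.mul_mem_left _ _ hy)) ?_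
    clear hm
    induction hz using Submodule.span_induction with
    | mem z hz =>
      obtain ⟨i, rfl⟩ := hz
      exact hgi i
    | zero => rw [mul_zero]; exact M.zero_mem
    | add _ _ _ _ h1 h2 =>
      rw [mul_add]
      exact M.add_mem h1 h2
    | smul c _ _ h1 =>
      rw [mul_smul_comm]
      exact M.smul_mem c h1
  have harr : ∀ a, arr k Q rel a ∈ M := by
    intro a
    by_cases ha : Recurrent rel a
    · exact hR (Sum.inr (⟨a, ha⟩, 0))
    · exact hN _ (hI a ha)
  have hx : x * 1 ∈ M := by
    refine mul_mem_of_generators M (fun v => hgen _ ?_) (fun b => hgen _ ?_) x 1 ?_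
    · rintro (w | ⟨⟨a, ha⟩, n⟩)
      · change vtx k Q rel v * vtx k Q rel w ∈ M
        rw [vtx_mul_vtx]
        split_ifs
        · exact hR (Sum.inl w)
        · exact M.zero_mem
      · change vtx k Q rel v * pathEl k rel a n ∈ M
        have hmem : pathEl k rel a n ∈ M := hR (Sum.inr (⟨a, ha⟩, n))
        obtain ⟨z, hz⟩ := exists_pathEl_eq_arr_mul k rel a n
        rw [hz] at hmem ⊢
        rw [← mul_assoc, vtx_mul_arr]
        split_ifs
        · exact hmem
        · rw [zero_mul]; exact M.zero_mem
    · rintro (w | ⟨⟨a, ha⟩, n⟩)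
      · change arr k Q rel b * vtx k Q rel w ∈ M
        rw [arr_mul_vtx]
        split_ifs
        · exact harr b
        · exact M.zero_mem
      · change arr k Q rel b * pathEl k rel a n ∈ M
        by_cases hba : Follows rel b a
        · have hmem : pathEl k rel b (n + 1) ∈ M :=
            hR (Sum.inr (⟨b, (hba.recurrent_iff hg).2 ha⟩, n + 1))
          rwa [pathEl, hba.next_eq hg] at hmem
        · obtain ⟨z, hz⟩ := exists_pathEl_eq_arr_mul k rel a n
          rw [hz, ← mul_assoc, arr_mul_arr_eq_zero hba, zero_mul]
          exact M.zero_mem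
    · rw [← sum_vtx]
      exact M.sum_mem fun v _ => hR (Sum.inl v)
  rw [mul_one] at hx
  obtain ⟨y, hy, z, hz, rfl⟩ := Submodule.mem_sup.1 hx
  obtain ⟨c, rfl⟩ := (Finsupp.mem_span_range_iff_exists_finsupp).1 hz
  exact ⟨y, hy, c, by rw [Finsupp.linearCombination_apply]⟩

open Classical in
/-- The sum of the entries in row `a` of the matrix of `x` on the orbit of `a`. -/
def rowSum (a : Q.Arr) : GA k Q rel →ₗ[k] Polynomial k where
  toFun x := (orbitHom k rel (Orbit rel a) x).mulVec 1 ⟨a, Relation.ReflTransGen.refl⟩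
  map_add' x y := by rw [map_add, Matrix.add_mulVec]; rfl
  map_smul' c x := by rw [map_smul, Matrix.smul_mulVec]; rfl

open Classical in
theorem orbitHom_pathEl_mulVec_one (hg : IsGentleRel Q rel) {a : Q.Arr} (ha : Recurrent rel a)
    (b : Q.Arr) (n : ℕ) (i : {c // Orbit rel a c}) :
    (orbitHom k rel (Orbit rel a) (pathEl k rel b n)).mulVec 1 i =
      if i.1 = b then Polynomial.X ^ (n + 1) else 0 := by
  induction n generalizing b i with
  | zero =>
    split_ifs with hib
    · subst hib
      have hf := (ha.of_orbit hg i.2).follows_next hg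
      rw [pathEl, orbitHom_arr_eq_single k rel hg (j := ⟨_, i.2.tail hf⟩) hf,
        Matrix.single_mulVec]
      simp
    · rw [pathEl, orbitHom_arr]
      simp [Matrix.mulVec, dotProduct, hib]
  | succ n ih =>
    rw [pathEl, map_mul, ← Matrix.mulVec_mulVec]
    split_ifs with hib
    · subst hib
      have hf := (ha.of_orbit hg i.2).follows_next hg
      rw [orbitHom_arr_eq_single k rel hg (j := ⟨_, i.2.tail hf⟩) hf, Matrix.single_mulVec, ih]
      simp [pow_succ']
    · rw [orbitHom_arr]
      simp [Matrix.mulVec, dotProduct, hib]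

theorem rowSum_pathEl (hg : IsGentleRel Q rel) {a : Q.Arr} (ha : Recurrent rel a)
    (b : Q.Arr) (n : ℕ) :
    rowSum k rel a (pathEl k rel b n) = if a = b then Polynomial.X ^ (n + 1) else 0 :=
  orbitHom_pathEl_mulVec_one k rel hg ha b n _

open Classical in
theorem rowSum_vtx (a : Q.Arr) (v : Q.V) :
    rowSum k rel a (vtx k Q rel v) = if v = Q.src a then 1 else 0 := by
  change (orbitHom k rel _ _).mulVec 1 _ = _
  rw [orbitHom_vtx, Matrix.mulVec_diagonal, Pi.one_apply, mul_one]

open Classical in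
theorem rowSum_eq_zero {a : Q.Arr} {x : GA k Q rel}
    (hx : x ∈ orbitIdeal k rel a) : rowSum k rel a x = 0 := by
  rw [mem_orbitIdeal] at hx
  change (orbitHom k rel _ _).mulVec 1 _ = _
  rw [hx, Matrix.zero_mulVec, Pi.zero_apply]

theorem vertexHom_pathEl (v : Q.V) (a : Q.Arr) (n : ℕ) :
    vertexHom k rel v (pathEl k rel a n) = 0 := by
  obtain ⟨z, hz⟩ := exists_pathEl_eq_arr_mul k rel a n
  rw [hz, map_mul, vertexHom_arr, zero_mul]

theorem coeff_eq_zero_of_dual {ι M : Type} [AddCommGroup M] [Module k M] [DecidableEq ι]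
    {f : ι → M} {c : ι →₀ k} {y : M} (φ : M →ₗ[k] k) (i : ι)
    (hφ : ∀ j, φ (f j) = if j = i then 1 else 0) (hy : φ y = 0)
    (hx : φ (y + Finsupp.linearCombination k f c) = 0) : c i = 0 := by
  rw [map_add, hy, zero_add, Finsupp.apply_linearCombination, Finsupp.linearCombination_apply]
    at hx
  simpa [hφ, Finsupp.sum] using hx

open Classical in
/-- An ideal containing the non-recurrent arrows and contained in the kernels of the vertex and
orbit representations contains the intersection of these kernels. -/
theorem mem_of_forall_mem_ker (hg : IsGentleRel Q rel) (I : TwoSidedIdeal (GA k Q rel))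
    (hI : ∀ a, ¬ Recurrent rel a → arr k Q rel a ∈ I)
    (hIv : ∀ v, I ≤ TwoSidedIdeal.ker (vertexHom k rel v))
    (hIo : ∀ a, Recurrent rel a → I ≤ orbitIdeal k rel a)
    {x : GA k Q rel} (hv : ∀ v, x ∈ TwoSidedIdeal.ker (vertexHom k rel v))
    (ho : ∀ a, Recurrent rel a → x ∈ orbitIdeal k rel a) :
    x ∈ I := by
  obtain ⟨y, hy, c, rfl⟩ := exists_eq_add_linearCombination k rel hg I hI x
  suffices hc : c = 0 by simpa [hc] using hy
  ext i
  rcases i with v | ⟨⟨a, ha⟩, n⟩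
  · refine coeff_eq_zero_of_dual k (vertexHom k rel v).toLinearMap (Sum.inl v) ?_
      ((TwoSidedIdeal.mem_ker (vertexHom k rel v)).1 (hIv v hy))
      ((TwoSidedIdeal.mem_ker (vertexHom k rel v)).1 (hv v))
    rintro (w | ⟨⟨b, hb⟩, m⟩)
    · simp [recurrentPath]
    · simp [recurrentPath, vertexHom_pathEl]
  · refine coeff_eq_zero_of_dual k (f := recurrentPath k rel) (y := y)
      (Polynomial.lcoeff k (n + 1) ∘ₗ rowSum k rel a)
      (Sum.inr (⟨a, ha⟩, n)) ?_ ?_ ?_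
    · rintro (w | ⟨⟨b, hb⟩, m⟩)
      · simp only [recurrentPath, Sum.elim_inl, LinearMap.comp_apply, rowSum_vtx,
          Polynomial.lcoeff_apply]
        split_ifs <;> simp_all [Polynomial.coeff_one]
      · simp only [recurrentPath, Sum.elim_inr, LinearMap.comp_apply, rowSum_pathEl k rel hg ha,
          Polynomial.lcoeff_apply]
        by_cases hab : a = b
        · subst hab
          simp [Polynomial.coeff_X_pow, eq_comm]
        · simp [hab, Ne.symm hab]
    · rw [LinearMap.comp_apply, rowSum_eq_zero k rel (hIo a ha hy), map_zero]
    · rw [LinearMap.comp_apply, rowSum_eq_zero k rel (ho a ha), map_zero]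

end Decomposition

/-- **Corollary 3.6 (cor:semiprime).** The prime radical of the (locally) gentle algebra
`A = kQ/I` (the intersection of all prime two-sided ideals) equals the two-sided ideal
generated by the arrows `α ∈ Q₁` whose maximal path `γ_α` is finite.  In particular `A` is
semiprime if and only if `A` has no finite maximal paths. -/
theorem statement9 (k : Type) [Field k] [CharZero k] (Q : Quiv)
    (rel : Q.Arr → Q.Arr → Prop) (hgentle : IsGentleRel Q rel) :
    {x : GA k Q rel | ∀ P : TwoSidedIdeal (GA k Q rel), IsPrimeTI k Q rel P → x ∈ P} =
      (TwoSidedIdeal.span {x | ∃ a : Q.Arr, FinThrough rel a ∧ x = arr k Q rel a} :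
        Set (GA k Q rel)) ∧
    ((∀ x : GA k Q rel,
        (∀ P : TwoSidedIdeal (GA k Q rel), IsPrimeTI k Q rel P → x ∈ P) → x = 0) ↔
      ¬ ∃ l : List Q.Arr, FiniteMaxWord rel l) := by
  set S : Set (GA k Q rel) := {x | ∃ a : Q.Arr, FinThrough rel a ∧ x = arr k Q rel a}
  have hsub : ∀ {x}, x ∈ S → x ∈ TwoSidedIdeal.span S := fun h => TwoSidedIdeal.subset_span h
  have hrad : ∀ x : GA k Q rel, (∀ P : TwoSidedIdeal (GA k Q rel), IsPrimeTI k Q rel P → x ∈ P) ↔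
      x ∈ TwoSidedIdeal.span S := by
    intro x
    constructor
    · intro hx
      refine mem_of_forall_mem_ker k rel hgentle _ (fun a ha => hsub
        ⟨a, (finThrough_iff hgentle a).2 ha, rfl⟩) (fun v => ?_) (fun a ha => ?_)
        (fun v => hx _ (isPrimeTI_ker_vertexHom k rel v))
        (fun a ha => hx _ (isPrimeTI_orbitIdeal k rel hgentle ha))
      · rw [TwoSidedIdeal.span_le]
        rintro _ ⟨a, -, rfl⟩
        exact (TwoSidedIdeal.mem_ker (vertexHom k rel v)).2 (vertexHom_arr k rel v a)
      · rw [TwoSidedIdeal.span_le]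
        rintro _ ⟨b, hb, rfl⟩
        refine arr_mem_orbitIdeal k rel fun hab => ?_
        exact (finThrough_iff hgentle b).1 hb (ha.of_orbit hgentle hab)
    · intro hx P hP
      refine (TwoSidedIdeal.span_le.2 ?_ : TwoSidedIdeal.span S ≤ P) hx
      rintro _ ⟨a, ha, rfl⟩
      refine or_self_iff.1 (hP.2 _ _ fun x => ?_)
      rw [arr_mul_mul_arr_eq_zero ((finThrough_iff hgentle a).1 ha)]
      exact P.zero_mem
  refine ⟨Set.ext hrad, ?_⟩
  simp only [hrad]
  constructor
  · rintro h ⟨l, hl⟩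
    obtain ⟨a, ha⟩ := List.exists_mem_of_ne_nil l hl.1.1
    exact arr_ne_zero k rel a (h _ (hsub ⟨a, ⟨l, hl, ha⟩, rfl⟩))
  · intro h x hx
    refine (TwoSidedIdeal.mem_bot _).1 ((TwoSidedIdeal.span_le.2 ?_ : TwoSidedIdeal.span S ≤ ⊥) hx)
    rintro _ ⟨a, ⟨l, hl, -⟩, -⟩
    exact absurd ⟨l, hl⟩ h

end LocGentle
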